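/- There exists a constant C > 0 such that for every natural number N ≥ 1, the Fourier representation of the fourth-power counterterm satisfies ∑_{j, k, l ∈ 𝓚_N, j+k+l ∈ 𝓚_N} 1/((4π²‖j‖² + 1)(4π²‖k‖² + 1)(4π²‖l‖² + 1)(4π²‖j+k+l‖² + 1)) ≤ C · N; this quantity equals ∫_{𝕋³} G_N(x)⁴ dx, which is therefore O(N). -/

import Mathlib

open MeasureTheory

/-- `energy k = 4π²‖k‖² + 1` for `k ∈ ℤ³`. -/
noncomputable def energy (k : ℤ × ℤ × ℤ) : ℝ :=
  4 * Real.pi ^ 2 * ((k.1 : ℝ) ^ 2 + (k.2.1 : ℝ) ^ 2 + (k.2.2 : ℝ) ^ 2) + 1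

/-- Membership of `k ∈ ℤ³` in `𝓚_N = {k : |k₁|+|k₂|+|k₃| ≤ N}` (as a decidable condition). -/
def inKN (N : ℕ) (k : ℤ × ℤ × ℤ) : Bool :=
  |k.1| + |k.2.1| + |k.2.2| ≤ (N : ℤ)

/-- The constrained lattice sum
`∑_{j,k,l ∈ 𝓚_N, j+k+l ∈ 𝓚_N} 1/(energy j · energy k · energy l · energy (j+k+l))`. -/
noncomputable def quarticSum (N : ℕ) : ℝ :=
  ∑' p : (ℤ × ℤ × ℤ) × (ℤ × ℤ × ℤ) × (ℤ × ℤ × ℤ),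
    if inKN N p.1 ∧ inKN N p.2.1 ∧ inKN N p.2.2 ∧ inKN N (p.1 + p.2.1 + p.2.2) then
      1 / (energy p.1 * energy p.2.1 * energy p.2.2 * energy (p.1 + p.2.1 + p.2.2))
    else 0

/-- The truncated Green function `G_N(x) = ∑_{k ∈ 𝓚_N} e^{2πi k·x}/(4π²‖k‖² + 1)` on the
torus `𝕋³ = (ℝ/ℤ)³`, viewed as a `ℤ³`-periodic function on `ℝ³`. -/
noncomputable def greenFn (N : ℕ) (x : ℝ × ℝ × ℝ) : ℂ :=
  ∑' k : ℤ × ℤ × ℤ,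
    if inKN N k then
      Complex.exp (2 * Real.pi * Complex.I *
        ((k.1 : ℂ) * (x.1 : ℂ) + (k.2.1 : ℂ) * (x.2.1 : ℂ) + (k.2.2 : ℂ) * (x.2.2 : ℂ))) /
        (energy k : ℂ)
    else 0

/-- The finite set `𝓚_N` of lattice points. -/
noncomputable def latticeBall (N : ℕ) : Finset (ℤ × ℤ × ℤ) :=
  {k ∈ Finset.Icc (-(N : ℤ)) N ×ˢ Finset.Icc (-(N : ℤ)) N ×ˢ Finset.Icc (-(N : ℤ)) N | inKN N k}

/-- The quadruples of points of `𝓚_N` with vanishing sum. -/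
noncomputable def zeroSumQuads (N : ℕ) : Finset (Fin 4 → ℤ × ℤ × ℤ) :=
  {f ∈ Fintype.piFinset fun _ => latticeBall N | ∑ i, f i = 0}

lemma mem_latticeBall {N : ℕ} {k : ℤ × ℤ × ℤ} : k ∈ latticeBall N ↔ inKN N k := by
  simp only [latticeBall, inKN, Finset.mem_filter, Finset.mem_product, Finset.mem_Icc,
    decide_eq_true_eq]
  grind

lemma mem_zeroSumQuads {N : ℕ} {f : Fin 4 → ℤ × ℤ × ℤ} :
    f ∈ zeroSumQuads N ↔ (∀ i, inKN N (f i)) ∧ ∑ i, f i = 0 := by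
  simp [zeroSumQuads, mem_latticeBall]

lemma inKN_neg (N : ℕ) (k : ℤ × ℤ × ℤ) : inKN N (-k) = inKN N k := by
  simp [inKN]

lemma energy_neg (k : ℤ × ℤ × ℤ) : energy (-k) = energy k := by
  simp [energy]

lemma one_le_energy (k : ℤ × ℤ × ℤ) : 1 ≤ energy k := by
  unfold energy
  have : 0 ≤ 4 * Real.pi ^ 2 * ((k.1 : ℝ) ^ 2 + (k.2.1 : ℝ) ^ 2 + (k.2.2 : ℝ) ^ 2) := by positivity
  linarith

lemma energy_pos (k : ℤ × ℤ × ℤ) : 0 < energy k := one_pos.trans_le (one_le_energy k)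

/-- Each coordinate of a lattice point is controlled by the square root of its energy. -/
lemma sq_natAbs_add_one_le_energy (k : ℤ × ℤ × ℤ) :
    ((k.1.natAbs : ℝ) + 1) ^ 2 ≤ energy k ∧ ((k.2.1.natAbs : ℝ) + 1) ^ 2 ≤ energy k ∧
      ((k.2.2.natAbs : ℝ) + 1) ^ 2 ≤ energy k := by
  have hπ : 3 ≤ 4 * Real.pi ^ 2 := by nlinarith [Real.pi_gt_three]
  have key : ∀ n : ℤ, ((n.natAbs : ℝ) + 1) ^ 2 ≤ 3 * (n : ℝ) ^ 2 + 1 := by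
    intro n
    have h1 : (n.natAbs : ℝ) ≤ (n.natAbs : ℝ) ^ 2 := by exact_mod_cast Nat.le_self_pow two_ne_zero _
    have h2 : (n.natAbs : ℝ) ^ 2 = (n : ℝ) ^ 2 := by
      rw [Nat.cast_natAbs, Int.cast_abs, sq_abs]
    nlinarith
  have hE : 3 * ((k.1 : ℝ) ^ 2 + (k.2.1 : ℝ) ^ 2 + (k.2.2 : ℝ) ^ 2) + 1 ≤ energy k := by
    unfold energy
    gcongr
  have a := sq_nonneg (k.1 : ℝ)
  have b := sq_nonneg (k.2.1 : ℝ)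
  have c := sq_nonneg (k.2.2 : ℝ)
  refine ⟨(key _).trans ?_, (key _).trans ?_, (key _).trans ?_⟩ <;> linarith

/-- The real cube root of `n + 1`. -/
noncomputable def succCbrt (n : ℕ) : ℝ := ((n : ℝ) + 1) ^ (1 / 3 : ℝ)

lemma succCbrt_pos (n : ℕ) : 0 < succCbrt n := by unfold succCbrt; positivity

lemma succCbrt_pow_three (n : ℕ) : succCbrt n ^ 3 = n + 1 := by
  rw [succCbrt, ← Real.rpow_natCast, ← Real.rpow_mul (by positivity)]
  norm_num

lemma sum_range_inv_succCbrt_sq_le (M : ℕ) :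
    ∑ n ∈ Finset.range (M + 1), 1 / succCbrt n ^ 2 ≤ 3 * succCbrt M := by
  induction M with
  | zero => norm_num [succCbrt]
  | succ M ih =>
    rw [Finset.sum_range_succ]
    have ha := succCbrt_pos M
    have hb := succCbrt_pos (M + 1)
    have h1 := succCbrt_pow_three M
    have h2 := succCbrt_pow_three (M + 1)
    push_cast at h2
    have hab : succCbrt M ≤ succCbrt (M + 1) :=
      le_of_pow_le_pow_left₀ three_ne_zero hb.le (by rw [h1, h2]; linarith)
    set a := succCbrt M
    set b := succCbrt (M + 1)
    have h3 : 1 ≤ 3 * (b - a) * b ^ 2 := by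
      nlinarith [mul_nonneg (sub_nonneg.2 hab) (sub_nonneg.2 hab),
        mul_nonneg (mul_nonneg (sub_nonneg.2 hab) (sub_nonneg.2 hab)) hb.le,
        mul_nonneg (mul_nonneg (sub_nonneg.2 hab) (sub_nonneg.2 hab)) ha.le]
    have h4 : 1 / b ^ 2 ≤ 3 * (b - a) := by rwa [div_le_iff₀ (by positivity)]
    linarith

lemma sum_Icc_inv_succCbrt_sq_le (M : ℕ) :
    ∑ x ∈ Finset.Icc (-(M : ℤ)) M, 1 / succCbrt x.natAbs ^ 2 ≤ 6 * succCbrt M := by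
  have hmaps : ∀ x ∈ Finset.Icc (-(M : ℤ)) M, x.natAbs ∈ Finset.range (M + 1) := by
    intro x hx
    simp only [Finset.mem_Icc, Finset.mem_range] at *
    omega
  rw [← Finset.sum_fiberwise_of_maps_to hmaps]
  have : ∀ n ∈ Finset.range (M + 1),
      ∑ x ∈ Finset.Icc (-(M : ℤ)) M with x.natAbs = n, 1 / succCbrt x.natAbs ^ 2
        ≤ 2 * (1 / succCbrt n ^ 2) := by
    intro n _
    have hcard : ({x ∈ Finset.Icc (-(M : ℤ)) M | x.natAbs = n} : Finset ℤ).card ≤ 2 := by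
      refine (Finset.card_le_card (t := {(n : ℤ), -(n : ℤ)}) ?_).trans Finset.card_le_two
      intro x hx
      simp only [Finset.mem_filter, Finset.mem_insert, Finset.mem_singleton] at *
      omega
    have hc := succCbrt_pos n
    rw [Finset.sum_congr rfl (g := fun _ => 1 / succCbrt n ^ 2)
      (fun x hx => by rw [(Finset.mem_filter.1 hx).2]), Finset.sum_const, nsmul_eq_mul]
    gcongr
    exact_mod_cast hcard
  refine (Finset.sum_le_sum this).trans ?_
  rw [← Finset.mul_sum]
  linarith [sum_range_inv_succCbrt_sq_le M]

lemma inv_energy_le (k : ℤ × ℤ × ℤ) :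
    1 / energy k ≤ 1 / succCbrt k.1.natAbs ^ 2 *
      (1 / succCbrt k.2.1.natAbs ^ 2 * (1 / succCbrt k.2.2.natAbs ^ 2)) := by
  have h1 := succCbrt_pos k.1.natAbs
  have h2 := succCbrt_pos k.2.1.natAbs
  have h3 := succCbrt_pos k.2.2.natAbs
  have hE := energy_pos k
  rw [one_div_mul_one_div, one_div_mul_one_div]
  refine one_div_le_one_div_of_le (by positivity) ?_
  refine le_of_pow_le_pow_left₀ three_ne_zero hE.le ?_
  obtain ⟨e1, e2, e3⟩ := sq_natAbs_add_one_le_energy k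
  calc _ = (succCbrt k.1.natAbs ^ 3) ^ 2 * ((succCbrt k.2.1.natAbs ^ 3) ^ 2 *
        (succCbrt k.2.2.natAbs ^ 3) ^ 2) := by ring
    _ ≤ energy k * (energy k * energy k) := by
        simp only [succCbrt_pow_three]
        gcongr
    _ = _ := by ring

/-- The sum of inverse energies over lattice points of energy at most `R` is `O(√R)`. -/
lemma sum_inv_energy_le (s : Finset (ℤ × ℤ × ℤ)) {R : ℝ} (hR : 1 ≤ R)
    (hs : ∀ k ∈ s, energy k ≤ R) : ∑ k ∈ s, 1 / energy k ≤ 216 * √R := by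
  obtain ⟨M, hM⟩ : ∃ M : ℕ, ⌊√R⌋₊ = M + 1 :=
    Nat.exists_eq_succ_of_ne_zero (Nat.floor_pos.2 (Real.one_le_sqrt.2 hR)).ne'
  have hle : ((M : ℝ) + 1) ≤ √R := by
    have := Nat.floor_le (Real.sqrt_nonneg R)
    rw [hM] at this
    exact_mod_cast this
  set I := Finset.Icc (-(M : ℤ)) M
  have hmem : ∀ x : ℤ, ((x.natAbs : ℝ) + 1) ^ 2 ≤ R → x ∈ I := by
    intro x hx
    have h : x.natAbs + 1 ≤ M + 1 := by
      rw [← hM]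
      exact Nat.le_floor (Real.le_sqrt_of_sq_le (by exact_mod_cast hx))
    simp only [I, Finset.mem_Icc]
    omega
  have hsub : s ⊆ I ×ˢ I ×ˢ I := by
    intro k hk
    obtain ⟨e1, e2, e3⟩ := sq_natAbs_add_one_le_energy k
    have := hs k hk
    simp only [Finset.mem_product]
    exact ⟨hmem _ (e1.trans this), hmem _ (e2.trans this), hmem _ (e3.trans this)⟩
  have hS := sum_Icc_inv_succCbrt_sq_le M
  have hS0 : 0 ≤ ∑ x ∈ I, 1 / succCbrt x.natAbs ^ 2 :=
    Finset.sum_nonneg fun _ _ => by positivity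
  calc ∑ k ∈ s, 1 / energy k
      ≤ ∑ k ∈ I ×ˢ I ×ˢ I, 1 / energy k :=
        Finset.sum_le_sum_of_subset_of_nonneg hsub fun k _ _ => (one_div_pos.2 (energy_pos k)).le
    _ ≤ ∑ k ∈ I ×ˢ I ×ˢ I, 1 / succCbrt k.1.natAbs ^ 2 *
          (1 / succCbrt k.2.1.natAbs ^ 2 * (1 / succCbrt k.2.2.natAbs ^ 2)) :=
        Finset.sum_le_sum fun k _ => inv_energy_le k
    _ = (∑ x ∈ I, 1 / succCbrt x.natAbs ^ 2) ^ 3 := by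
        simp only [Finset.sum_product, ← Finset.mul_sum, ← Finset.sum_mul]
        ring
    _ ≤ (6 * succCbrt M) ^ 3 := by gcongr
    _ = 216 * (M + 1) := by rw [mul_pow, succCbrt_pow_three]; norm_num
    _ ≤ 216 * √R := by gcongr

lemma energy_le_of_inKN {N : ℕ} (hN : 1 ≤ N) {k : ℤ × ℤ × ℤ} (hk : inKN N k) :
    energy k ≤ (7 * N) ^ 2 := by
  have hk' : |(k.1 : ℝ)| + |(k.2.1 : ℝ)| + |(k.2.2 : ℝ)| ≤ N := by
    simp only [inKN, decide_eq_true_eq] at hk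
    exact_mod_cast hk
  have hN' : (1 : ℝ) ≤ N := by exact_mod_cast hN
  have hsq : (k.1 : ℝ) ^ 2 + (k.2.1 : ℝ) ^ 2 + (k.2.2 : ℝ) ^ 2 ≤ (N : ℝ) ^ 2 := by
    refine le_trans ?_ (pow_le_pow_left₀ (by positivity) hk' 2)
    rw [← sq_abs (k.1 : ℝ), ← sq_abs (k.2.1 : ℝ), ← sq_abs (k.2.2 : ℝ)]
    have a := abs_nonneg (k.1 : ℝ)
    have b := abs_nonneg (k.2.1 : ℝ)
    have c := abs_nonneg (k.2.2 : ℝ)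
    nlinarith [mul_nonneg a b, mul_nonneg a c, mul_nonneg b c]
  have hπ : 4 * Real.pi ^ 2 ≤ 48 := by nlinarith [Real.pi_lt_d2, Real.pi_pos]
  calc energy k ≤ 48 * (N : ℝ) ^ 2 + 1 := by unfold energy; gcongr
    _ ≤ _ := by nlinarith

lemma sum_latticeBall_inv_energy_le {N : ℕ} (hN : 1 ≤ N) :
    ∑ k ∈ latticeBall N, 1 / energy k ≤ 1512 * N := by
  have hN' : (1 : ℝ) ≤ N := by exact_mod_cast hN
  have := sum_inv_energy_le (latticeBall N) (R := (7 * N) ^ 2) (by nlinarith)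
    fun k hk => energy_le_of_inKN hN (mem_latticeBall.1 hk)
  rw [Real.sqrt_sq (by positivity)] at this
  linarith

/-- Sorting the four frequencies by energy costs a factor `4!`. -/
lemma sum_zeroSumQuads_le_sum_monotone (N : ℕ) :
    ∑ f ∈ zeroSumQuads N, ∏ i, 1 / energy (f i) ≤
      24 * ∑ f ∈ zeroSumQuads N with Monotone (energy ∘ f), ∏ i, 1 / energy (f i) := by
  classical
  have hpos : ∀ f : Fin 4 → ℤ × ℤ × ℤ, 0 ≤ ∏ i, 1 / energy (f i) := fun f =>
    Finset.prod_nonneg fun i _ => (one_div_pos.2 (energy_pos _)).le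
  calc ∑ f ∈ zeroSumQuads N, ∏ i, 1 / energy (f i)
      ≤ ∑ f ∈ zeroSumQuads N, ∑ σ : Equiv.Perm (Fin 4),
          if Monotone (energy ∘ f ∘ σ) then ∏ i, 1 / energy (f i) else 0 := by
        refine Finset.sum_le_sum fun f _ => ?_
        have h := Finset.single_le_sum (s := Finset.univ)
          (f := fun σ : Equiv.Perm (Fin 4) =>
            if Monotone (energy ∘ f ∘ σ) then ∏ i, 1 / energy (f i) else 0)
          (fun σ _ => by split_ifs; exacts [hpos f, le_rfl])
          (Finset.mem_univ (Tuple.sort (energy ∘ f)))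
        refine le_trans (le_of_eq ?_) h
        exact (if_pos (Tuple.monotone_sort (energy ∘ f))).symm
    _ = ∑ σ : Equiv.Perm (Fin 4), ∑ f ∈ zeroSumQuads N,
          if Monotone (energy ∘ f ∘ σ) then ∏ i, 1 / energy (f i) else 0 := Finset.sum_comm
    _ = ∑ _σ : Equiv.Perm (Fin 4), ∑ f ∈ zeroSumQuads N,
          if Monotone (energy ∘ f) then ∏ i, 1 / energy (f i) else 0 := by
        refine Finset.sum_congr rfl fun σ _ => ?_
        refine Finset.sum_nbij' (fun f => f ∘ σ) (fun f => f ∘ σ.symm) ?_ ?_ ?_ ?_ ?_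
        · intro f hf
          rw [mem_zeroSumQuads] at *
          exact ⟨fun i => hf.1 _, by rw [← hf.2]; exact Equiv.sum_comp σ f⟩
        · intro f hf
          rw [mem_zeroSumQuads] at *
          exact ⟨fun i => hf.1 _, by rw [← hf.2]; exact Equiv.sum_comp σ.symm f⟩
        · intro f _
          ext1 i
          simp
        · intro f _
          ext1 i
          simp
        · intro f _
          congr 1
          exact (Equiv.prod_comp σ fun i => 1 / energy (f i)).symm
    _ = _ := by
        rw [Finset.sum_const, Finset.card_univ, Fintype.card_perm, Fintype.card_fin, nsmul_eq_mul,
          Finset.sum_filter]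
        norm_num [Nat.factorial]

lemma sum_monotone_zeroSumQuads_le {N : ℕ} (hN : 1 ≤ N) :
    ∑ f ∈ zeroSumQuads N with Monotone (energy ∘ f), ∏ i, 1 / energy (f i) ≤
      216 ^ 2 * (1512 * N) := by
  classical
  set K := latticeBall N
  let S : Finset (Σ _ : ℤ × ℤ × ℤ, (ℤ × ℤ × ℤ) × (ℤ × ℤ × ℤ)) :=
    K.sigma fun c => {a ∈ K | energy a ≤ energy c} ×ˢ {b ∈ K | energy b ≤ energy c}
  let g : (Σ _ : ℤ × ℤ × ℤ, (ℤ × ℤ × ℤ) × (ℤ × ℤ × ℤ)) → ℝ := fun p =>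
    (1 / energy p.1) ^ 2 * (1 / energy p.2.1 * (1 / energy p.2.2))
  let φ : (Fin 4 → ℤ × ℤ × ℤ) → Σ _ : ℤ × ℤ × ℤ, (ℤ × ℤ × ℤ) × (ℤ × ℤ × ℤ) :=
    fun f => ⟨f 2, f 0, f 1⟩
  have hinv : ∀ k, 0 ≤ 1 / energy k := fun k => (one_div_pos.2 (energy_pos k)).le
  set T := {f ∈ zeroSumQuads N | Monotone (energy ∘ f)}
  have hinj : Set.InjOn φ T := by
    intro f hf f' hf' h
    have h2 := (mem_zeroSumQuads.1 (Finset.mem_filter.1 hf).1).2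
    have h2' := (mem_zeroSumQuads.1 (Finset.mem_filter.1 hf').1).2
    simp only [φ, Sigma.mk.injEq, heq_eq_eq, Prod.mk.injEq] at h
    obtain ⟨e2, e0, e1⟩ := h
    rw [Fin.sum_univ_four] at h2 h2'
    have e3 : f 3 = f' 3 := by
      rw [eq_neg_of_add_eq_zero_right h2, eq_neg_of_add_eq_zero_right h2', e0, e1, e2]
    ext1 i
    fin_cases i <;> assumption
  have hmaps : ∀ f ∈ T, φ f ∈ S := by
    intro f hf
    obtain ⟨hf, hm⟩ := Finset.mem_filter.1 hf
    have hK : ∀ i, f i ∈ K := fun i => mem_latticeBall.2 ((mem_zeroSumQuads.1 hf).1 i)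
    simp only [S, φ, Finset.mem_sigma, Finset.mem_product, Finset.mem_filter]
    exact ⟨hK 2, ⟨hK 0, hm (by decide)⟩, hK 1, hm (by decide)⟩
  calc ∑ f ∈ T, ∏ i, 1 / energy (f i)
      ≤ ∑ f ∈ T, g (φ f) := by
        refine Finset.sum_le_sum fun f hf => ?_
        have hm := (Finset.mem_filter.1 hf).2
        have h32 : 1 / energy (f 3) ≤ 1 / energy (f 2) :=
          one_div_le_one_div_of_le (energy_pos _) (hm (by decide : (2 : Fin 4) ≤ 3))
        rw [Fin.prod_univ_four]
        have := mul_le_mul_of_nonneg_left h32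
          (mul_nonneg (mul_nonneg (hinv (f 0)) (hinv (f 1))) (hinv (f 2)))
        refine this.trans (le_of_eq ?_)
        simp only [g, φ]
        ring
    _ = ∑ p ∈ T.image φ, g p := (Finset.sum_image hinj).symm
    _ ≤ ∑ p ∈ S, g p := by
        refine Finset.sum_le_sum_of_subset_of_nonneg (Finset.image_subset_iff.2 hmaps) ?_
        intro p _ _
        exact mul_nonneg (sq_nonneg _) (mul_nonneg (hinv _) (hinv _))
    _ = ∑ c ∈ K, (1 / energy c) ^ 2 * (∑ a ∈ K with energy a ≤ energy c, 1 / energy a) ^ 2 := by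
        simp only [S, g, Finset.sum_sigma, Finset.sum_product, ← Finset.mul_sum, ← Finset.sum_mul]
        refine Finset.sum_congr rfl fun c _ => ?_
        ring
    _ ≤ ∑ c ∈ K, 216 ^ 2 * (1 / energy c) := by
        refine Finset.sum_le_sum fun c _ => ?_
        have h := sum_inv_energy_le {a ∈ K | energy a ≤ energy c} (one_le_energy c)
          fun a ha => (Finset.mem_filter.1 ha).2
        have hc := energy_pos c
        calc _ ≤ (1 / energy c) ^ 2 * (216 * √(energy c)) ^ 2 := by
              have := Finset.sum_nonneg (s := {a ∈ K | energy a ≤ energy c}) fun a _ => hinv a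
              gcongr
          _ = _ := by
              rw [mul_pow, Real.sq_sqrt hc.le]
              field_simp
    _ ≤ 216 ^ 2 * (1512 * N) := by
        rw [← Finset.mul_sum]
        gcongr
        exact sum_latticeBall_inv_energy_le hN

lemma quarticSum_eq_sum_zeroSumQuads (N : ℕ) :
    quarticSum N = ∑ f ∈ zeroSumQuads N, ∏ i, 1 / energy (f i) := by
  classical
  set K := latticeBall N
  have h : quarticSum N = ∑ p ∈ K ×ˢ K ×ˢ K with inKN N (p.1 + p.2.1 + p.2.2),
      1 / (energy p.1 * energy p.2.1 * energy p.2.2 * energy (p.1 + p.2.1 + p.2.2)) := by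
    rw [quarticSum, tsum_eq_sum (s := {p ∈ K ×ˢ K ×ˢ K | inKN N (p.1 + p.2.1 + p.2.2)})]
    · refine Finset.sum_congr rfl fun p hp => if_pos ?_
      simpa [K, mem_latticeBall, and_assoc] using hp
    · intro p hp
      refine if_neg fun h => hp ?_
      simpa [K, mem_latticeBall, and_assoc] using h
  rw [h]
  refine Finset.sum_nbij' (fun p => ![p.1, p.2.1, p.2.2, -(p.1 + p.2.1 + p.2.2)])
    (fun f => (f 0, f 1, f 2)) ?_ ?_ ?_ ?_ ?_
  · intro p hp
    simp only [K, Finset.mem_filter, Finset.mem_product, mem_latticeBall] at hp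
    rw [mem_zeroSumQuads]
    constructor
    · intro i
      fin_cases i
      · exact hp.1.1
      · exact hp.1.2.1
      · exact hp.1.2.2
      · exact (inKN_neg N _).trans hp.2
    · simp [Fin.sum_univ_four]
  · intro f hf
    rw [mem_zeroSumQuads, Fin.sum_univ_four] at hf
    simp only [K, Finset.mem_filter, Finset.mem_product, mem_latticeBall]
    refine ⟨⟨hf.1 0, hf.1 1, hf.1 2⟩, ?_⟩
    rw [eq_neg_of_add_eq_zero_left hf.2, inKN_neg]
    exact hf.1 3
  · intro p _
    rfl
  · intro f hf
    rw [mem_zeroSumQuads, Fin.sum_univ_four] at hf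
    ext1 i
    fin_cases i
    · rfl
    · rfl
    · rfl
    · exact (eq_neg_of_add_eq_zero_right hf.2).symm
  · intro p _
    simp [Fin.prod_univ_four, energy_neg, -neg_add_rev]

lemma quarticSum_le {N : ℕ} (hN : 1 ≤ N) :
    quarticSum N ≤ 24 * (216 ^ 2 * 1512) * N := by
  rw [quarticSum_eq_sum_zeroSumQuads]
  linarith [sum_zeroSumQuads_le_sum_monotone N, sum_monotone_zeroSumQuads_le hN]

/-- The character `x ↦ e^{2πi k·x}`. -/
noncomputable def latticeChar (k : ℤ × ℤ × ℤ) (x : ℝ × ℝ × ℝ) : ℂ :=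
  Complex.exp (2 * Real.pi * Complex.I *
    ((k.1 : ℂ) * (x.1 : ℂ) + (k.2.1 : ℂ) * (x.2.1 : ℂ) + (k.2.2 : ℂ) * (x.2.2 : ℂ)))

lemma continuous_latticeChar (k : ℤ × ℤ × ℤ) : Continuous (latticeChar k) := by
  unfold latticeChar
  fun_prop

lemma prod_latticeChar {ι : Type*} (s : Finset ι) (f : ι → ℤ × ℤ × ℤ) (x : ℝ × ℝ × ℝ) :
    ∏ i ∈ s, latticeChar (f i) x = latticeChar (∑ i ∈ s, f i) x := by
  simp only [latticeChar, ← Complex.exp_sum, Prod.fst_sum, Prod.snd_sum, Int.cast_sum,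
    Finset.sum_mul, ← Finset.mul_sum, ← Finset.sum_add_distrib]

lemma greenFn_eq_sum (N : ℕ) (x : ℝ × ℝ × ℝ) :
    greenFn N x = ∑ k ∈ latticeBall N, latticeChar k x * ((1 / energy k : ℝ) : ℂ) := by
  rw [greenFn, tsum_eq_sum (s := latticeBall N)]
  · refine Finset.sum_congr rfl fun k hk => ?_
    rw [if_pos (mem_latticeBall.1 hk), latticeChar]
    push_cast
    ring
  · intro k hk
    exact if_neg fun h => hk (mem_latticeBall.2 h)

lemma greenFn_pow_four (N : ℕ) (x : ℝ × ℝ × ℝ) :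
    greenFn N x ^ 4 = ∑ f ∈ Fintype.piFinset fun _ : Fin 4 => latticeBall N,
      latticeChar (∑ i, f i) x * ((∏ i, 1 / energy (f i) : ℝ) : ℂ) := by
  have h : greenFn N x ^ 4 = ∏ _i : Fin 4, greenFn N x := by simp
  rw [h, greenFn_eq_sum, Finset.prod_univ_sum]
  refine Finset.sum_congr rfl fun f _ => ?_
  rw [Finset.prod_mul_distrib, prod_latticeChar, Complex.ofReal_prod]

lemma setIntegral_Icc_exp_int (n : ℤ) :
    ∫ t in Set.Icc (0 : ℝ) 1, Complex.exp (2 * Real.pi * Complex.I * n * t) =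
      if n = 0 then 1 else 0 := by
  rw [integral_Icc_eq_integral_Ioc, ← intervalIntegral.integral_of_le zero_le_one]
  split_ifs with h
  · simp [h]
  · have hc : (2 * Real.pi * Complex.I * n : ℂ) ≠ 0 := by simp [h, Real.pi_ne_zero]
    rw [integral_exp_mul_complex hc]
    have : Complex.exp (2 * Real.pi * Complex.I * n) = 1 :=
      Complex.exp_eq_one_iff.2 ⟨n, by ring⟩
    simp [this]

lemma setIntegral_latticeChar (k : ℤ × ℤ × ℤ) :
    ∫ x in Set.Icc (0 : ℝ × ℝ × ℝ) 1, latticeChar k x = if k = 0 then 1 else 0 := by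
  have hset : Set.Icc (0 : ℝ × ℝ × ℝ) 1 =
      Set.Icc (0 : ℝ) 1 ×ˢ (Set.Icc (0 : ℝ) 1 ×ˢ Set.Icc (0 : ℝ) 1) := by
    rw [Set.Icc_prod_Icc, Set.Icc_prod_Icc]
    rfl
  let e : ℤ → ℝ → ℂ := fun n t => Complex.exp (2 * Real.pi * Complex.I * n * t)
  have hchar : ∀ x, latticeChar k x = e k.1 x.1 * (e k.2.1 x.2.1 * e k.2.2 x.2.2) := by
    intro x
    simp only [latticeChar, e, ← Complex.exp_add]
    congr 1
    ring
  simp only [hchar]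
  rw [hset, Measure.volume_eq_prod, setIntegral_prod_mul (e k.1)
    (fun y : ℝ × ℝ => e k.2.1 y.1 * e k.2.2 y.2), Measure.volume_eq_prod,
    setIntegral_prod_mul (e k.2.1) (e k.2.2)]
  simp only [e, setIntegral_Icc_exp_int]
  obtain ⟨a, b, c⟩ := k
  by_cases ha : a = 0 <;> by_cases hb : b = 0 <;> by_cases hc : c = 0 <;> simp [ha, hb, hc]

lemma setIntegral_greenFn_pow_four (N : ℕ) :
    ∫ x in Set.Icc (0 : ℝ × ℝ × ℝ) 1, greenFn N x ^ 4 = (quarticSum N : ℂ) := by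
  simp only [greenFn_pow_four]
  rw [integral_finsetSum]
  · simp only [integral_mul_const, setIntegral_latticeChar]
    rw [quarticSum_eq_sum_zeroSumQuads, zeroSumQuads, Finset.sum_filter, Complex.ofReal_sum]
    refine Finset.sum_congr rfl fun f _ => ?_
    split_ifs <;> simp
  · intro f _
    exact ((continuous_latticeChar _).mul continuous_const).continuousOn.integrableOn_compact
      isCompact_Icc


/-- There is `C > 0` such that for all `N ≥ 1` the quartic lattice sum is at most `C·N`;
this quantity equals `∫_{𝕋³} G_N(x)⁴ dx`, which is therefore `O(N)`. -/
theorem stmt18 :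
    ∃ C > (0 : ℝ), ∀ N : ℕ, 1 ≤ N →
      quarticSum N ≤ C * N ∧
      (∫ x in Set.Icc (0 : ℝ × ℝ × ℝ) 1, (greenFn N x) ^ 4) = (quarticSum N : ℂ) := by
  exact ⟨24 * (216 ^ 2 * 1512), by norm_num, fun N hN =>
    ⟨quarticSum_le hN, setIntegral_greenFn_pow_four N⟩⟩
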